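/- arXiv:2406.15380 — 3 statements merged into one kernel-verified Lean document; each statement's English description precedes it below -/
import Mathlib

section
/- Let ε > 0, let I ⊆ ℝ be a nonempty, non-singleton interval, and let f : I → ℝ be an ε-affine function. Then there exists an affine function A : I → ℝ (i.e., A(x) = ax + b for some constants a, b ∈ ℝ) such that |f(x) − A(x)| ≤ ε for all x ∈ I. -/
/-- Two chords of an `ε`-affine function can be compared at a common barycenter, so the slopes
`(f x - f y - 2ε) / (x - y)` never exceed the slopes `(f u - f v + 2ε) / (u - v)`. -/
lemma slope_sub_le_slope_add {ε : ℝ} {I : Set ℝ} {f : ℝ → ℝ}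
    (hf : ∀ x ∈ I, ∀ y ∈ I, ∀ t ∈ Set.Icc (0:ℝ) 1,
      |f (t * x + (1 - t) * y) - t * f x - (1 - t) * f y| ≤ ε)
    {x y u v : ℝ} (hx : x ∈ I) (hy : y ∈ I) (hu : u ∈ I) (hv : v ∈ I)
    (hyx : y < x) (hvu : v < u) :
    (f x - f y - 2 * ε) / (x - y) ≤ (f u - f v + 2 * ε) / (u - v) := by
  have hp : 0 < x - y := sub_pos.2 hyx
  have hq : 0 < u - v := sub_pos.2 hvu
  have hT : 0 < (u - v) + (x - y) := by positivity
  obtain ⟨t, ht⟩ : ∃ t, t = (u - v) / ((u - v) + (x - y)) := ⟨_, rfl⟩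
  have htT : t * ((u - v) + (x - y)) = u - v := by rw [ht]; field_simp
  have ht01 : t ∈ Set.Icc (0:ℝ) 1 := by
    rw [ht]
    exact ⟨by positivity, (div_le_one hT).2 (by linarith)⟩
  have hbary : t * x + (1 - t) * v = t * y + (1 - t) * u := by linarith
  have h₁ := (abs_le.1 (hf x hx v hv t ht01)).1
  have h₂ := (abs_le.1 (hf y hy u hu t ht01)).2
  rw [hbary] at h₁
  have h₃ : t * (f x - f y) ≤ (1 - t) * (f u - f v) + 2 * ε := by linarith
  have h₄ := mul_le_mul_of_nonneg_right h₃ hT.le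
  rw [div_le_div_iff₀ hp hq]
  linear_combination h₄ - (f x - f y + f u - f v) * htT

/-- For ε > 0, a nonempty non-singleton interval `I ⊆ ℝ` (a convex set
containing two distinct points), and an ε-affine function `f` on `I`
(i.e. `|f(tx+(1-t)y) - t f(x) - (1-t) f(y)| ≤ ε` for all `x, y ∈ I`, `t ∈ [0,1]`),
there exists an affine function `A x = a*x + b` with `|f x - A x| ≤ ε` on `I`. -/
theorem eps_affine_function_stability
    (ε : ℝ) (hε : 0 < ε) (I : Set ℝ) (hI : Convex ℝ I)
    (hI2 : ∃ x ∈ I, ∃ y ∈ I, x ≠ y) (f : ℝ → ℝ)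
    (hf : ∀ x ∈ I, ∀ y ∈ I, ∀ t ∈ Set.Icc (0:ℝ) 1,
      |f (t * x + (1 - t) * y) - t * f x - (1 - t) * f y| ≤ ε) :
    ∃ a b : ℝ, ∀ x ∈ I, |f x - (a * x + b)| ≤ ε := by
  obtain ⟨a, ha⟩ : ∃ a, ∀ x ∈ I, ∀ y ∈ I, y < x →
      f x - f y - 2 * ε ≤ a * (x - y) ∧ a * (x - y) ≤ f x - f y + 2 * ε := by
    obtain ⟨p, hp, q, hq, hqp⟩ : ∃ p ∈ I, ∃ q ∈ I, q < p := by
      obtain ⟨x, hx, y, hy, hxy⟩ := hI2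
      rcases hxy.lt_or_gt with h | h
      exacts [⟨y, hy, x, hx, h⟩, ⟨x, hx, y, hy, h⟩]
    obtain ⟨a, hlow, hupp⟩ := exists_between_of_forall_le
      (s := {m | ∃ x ∈ I, ∃ y ∈ I, y < x ∧ (f x - f y - 2 * ε) / (x - y) = m})
      (t := {m | ∃ x ∈ I, ∃ y ∈ I, y < x ∧ (f x - f y + 2 * ε) / (x - y) = m})
      ⟨_, p, hp, q, hq, hqp, rfl⟩ ⟨_, p, hp, q, hq, hqp, rfl⟩ (by
        rintro _ ⟨x, hx, y, hy, hyx, rfl⟩ _ ⟨u, hu, v, hv, hvu, rfl⟩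
        exact slope_sub_le_slope_add hf hx hy hu hv hyx hvu)
    refine ⟨a, fun x hx y hy hyx => ⟨?_, ?_⟩⟩
    · exact (div_le_iff₀ (sub_pos.2 hyx)).1 (hlow ⟨x, hx, y, hy, hyx, rfl⟩)
    · exact (le_div_iff₀ (sub_pos.2 hyx)).1 (hupp ⟨x, hx, y, hy, hyx, rfl⟩)
  obtain ⟨p, hp, -⟩ := hI2
  obtain ⟨b, hlow, hupp⟩ := exists_between_of_forall_le
    (s := (fun x => f x - a * x - ε) '' I) (t := (fun x => f x - a * x + ε) '' I)
    ⟨_, p, hp, rfl⟩ ⟨_, p, hp, rfl⟩ (by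
      rintro _ ⟨x, hx, rfl⟩ _ ⟨y, hy, rfl⟩
      dsimp only
      rcases lt_trichotomy x y with h | rfl | h
      · linarith [(ha y hy x hx h).2]
      · linarith
      · linarith [(ha x hx y hy h).1])
  refine ⟨a, b, fun x hx => abs_le.2 ⟨?_, ?_⟩⟩
  · linarith [hupp ⟨x, hx, rfl⟩]
  · linarith [hlow ⟨x, hx, rfl⟩]
end

section
/- Let ε > 0, let ⟨uₙ⟩ₙ₌₀^∞ be a sequence of real numbers, and let f : ℝ₊ → ℝ be its piecewise linear interpolation, i.e., f(x) := t·u_{n−1} + (1−t)·uₙ whenever x = t(n−1) + (1−t)n with t ∈ [0,1] and n ∈ ℕ. Let n₁, n₂ ∈ ℕ with n₁ < n₂, and let x, y ∈ ℝ₊ with x < y, x ∈ [n₁, n₁+1], and y ∈ [n₂−1, n₂]. Then (f(y) − f(x) − ε)/(y − x) ≤ max over n ∈ ℕ with n₁ ≤ n ≤ n₂−1 of ( f(n+1) − f(n) − ε/(n₂ − n₁) ). -/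
/-- A sequence whose increments on `[a, b)` are at most `M` grows by at most `M * (b - a)`. -/
theorem sub_le_mul_of_increments_le (u : ℕ → ℝ) (M : ℝ) {a b : ℕ} (hab : a ≤ b)
    (h : ∀ n, a ≤ n → n < b → u (n + 1) - u n ≤ M) :
    u b - u a ≤ M * ((b : ℝ) - a) := by
  induction b, hab using Nat.le_induction with
  | base => simp
  | succ b hab ih =>
    have h₁ := ih fun n hn hnb => h n hn (by omega)
    have h₂ := h b hab (by omega)
    push_cast
    linarith

/-- let `f` be the piecewise linear interpolation of the sequence
`u` (so `f (t(n-1) + (1-t)n) = t u_{n-1} + (1-t) uₙ` for `t ∈ [0,1]`, `n ≥ 1`).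
For `n₁ < n₂` and `x < y` with `x ∈ [n₁, n₁+1]`, `y ∈ [n₂-1, n₂]`,
`(f y - f x - ε)/(y - x) ≤ max_{n₁ ≤ n ≤ n₂-1} (f(n+1) - f(n) - ε/(n₂ - n₁))`. -/
theorem interpolation_upper_slope_bound
    (ε : ℝ) (hε : 0 < ε) (u : ℕ → ℝ) (f : ℝ → ℝ)
    (hf : ∀ (n : ℕ) (t : ℝ), 1 ≤ n → t ∈ Set.Icc (0:ℝ) 1 →
      f (t * ((n : ℝ) - 1) + (1 - t) * (n : ℝ)) = t * u (n - 1) + (1 - t) * u n)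
    (n₁ n₂ : ℕ) (h12 : n₁ < n₂) (x y : ℝ) (hx0 : 0 ≤ x) (hxy : x < y)
    (hx : x ∈ Set.Icc (n₁ : ℝ) ((n₁ : ℝ) + 1))
    (hy : y ∈ Set.Icc ((n₂ : ℝ) - 1) (n₂ : ℝ)) :
    (f y - f x - ε) / (y - x) ≤
      (Finset.Icc n₁ (n₂ - 1)).sup' (Finset.nonempty_Icc.mpr (by omega))
        (fun n => f ((n : ℝ) + 1) - f (n : ℝ) - ε / ((n₂ : ℝ) - (n₁ : ℝ))) := by
  have affine : ∀ (n : ℕ) (z : ℝ), (n : ℝ) ≤ z → z ≤ n + 1 →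
      f z = u n + (z - n) * (u (n + 1) - u n) := by
    intro n z h₁ h₂
    have h := hf (n + 1) (n + 1 - z) (by omega) ⟨by linarith, by linarith⟩
    push_cast at h
    convert h using 1
    · congr 1
      ring
    · ring
  obtain ⟨m, rfl⟩ : ∃ m, n₂ = m + 1 := ⟨n₂ - 1, by omega⟩
  obtain ⟨hx₁, hx₂⟩ := hx
  obtain ⟨hy₁, hy₂⟩ := hy
  push_cast at hy₁ hy₂
  set S := (Finset.Icc n₁ (m + 1 - 1)).sup' (Finset.nonempty_Icc.mpr (by omega))
    (fun n => f ((n : ℝ) + 1) - f (n : ℝ) - ε / (((m + 1 : ℕ) : ℝ) - (n₁ : ℝ))) with hS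
  set δ := ε / (((m + 1 : ℕ) : ℝ) - (n₁ : ℝ)) with hδ
  have increment : ∀ n, n₁ ≤ n → n ≤ m → u (n + 1) - u n ≤ S + δ := by
    intro n h₁ h₂
    have h := Finset.le_sup' (fun n : ℕ => f ((n : ℝ) + 1) - f (n : ℝ) - δ)
      (Finset.mem_Icc.mpr ⟨h₁, (by omega : n ≤ m + 1 - 1)⟩)
    rw [← hS] at h
    have e₁ := affine n n le_rfl (by linarith)
    have e₂ := affine n (n + 1) (by linarith) le_rfl
    simp only [e₁, e₂] at h
    linarith
  have slope : f y - f x ≤ (S + δ) * (y - x) := by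
    rw [affine n₁ x hx₁ hx₂, affine m y (by linarith) hy₂]
    rcases (show n₁ ≤ m by omega).eq_or_lt with rfl | hlt
    · nlinarith [increment n₁ le_rfl le_rfl]
    · have h₁ := mul_le_mul_of_nonneg_left (increment n₁ le_rfl hlt.le)
        (show (0 : ℝ) ≤ n₁ + 1 - x by linarith)
      have h₂ := mul_le_mul_of_nonneg_left (increment m hlt.le le_rfl)
        (show (0 : ℝ) ≤ y - m by linarith)
      have h₃ := sub_le_mul_of_increments_le u (S + δ) (show n₁ + 1 ≤ m from hlt)
        fun n hn hnm => increment n (by omega) hnm.le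
      push_cast at h₃
      linarith
  have hδ_le : δ * (y - x) ≤ ε := by
    have hpos : (0 : ℝ) < ((m + 1 : ℕ) : ℝ) - n₁ := sub_pos.mpr (by exact_mod_cast h12)
    rw [hδ, div_mul_eq_mul_div, div_le_iff₀ hpos]
    apply mul_le_mul_of_nonneg_left _ hε.le
    push_cast
    linarith
  rw [div_le_iff₀ (sub_pos.mpr hxy)]
  linarith
end

section
/- Let ε > 0, let I ⊆ ℝ be a nonempty, non-singleton interval, and let f : I → ℝ be an ε-affine function. Then there exist a convex function C̄ : I → ℝ and a concave function C̲ : I → ℝ such that C̲(x) − ε/2 ≤ f(x) ≤ C̄(x) + ε/2 for all x ∈ I; in particular, the concave function C̲ − ε/2 lies everywhere below the convex function C̄ + ε/2 on I. -/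
/-- An `ε`-affine function satisfies the three-point inequality with denominators cleared. -/
theorem abs_three_point_le {ε : ℝ} {I : Set ℝ} {f : ℝ → ℝ}
    (hf : ∀ x ∈ I, ∀ y ∈ I, ∀ t ∈ Set.Icc (0 : ℝ) 1,
      |f (t * x + (1 - t) * y) - t * f x - (1 - t) * f y| ≤ ε)
    {p q r : ℝ} (hp : p ∈ I) (hr : r ∈ I) (hpq : p ≤ q) (hqr : q ≤ r) (hpr : p < r) :
    |(r - p) * f q - (r - q) * f p - (q - p) * f r| ≤ ε * (r - p) := by
  have hd : 0 < r - p := sub_pos.2 hpr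
  have h := hf p hp r hr ((r - q) / (r - p))
    ⟨div_nonneg (by linarith) hd.le, (div_le_one hd).2 (by linarith)⟩
  have hq : (r - q) / (r - p) * p + (1 - (r - q) / (r - p)) * r = q := by
    field_simp
    ring
  rw [hq] at h
  have key : (r - p) * f q - (r - q) * f p - (q - p) * f r =
      (f q - (r - q) / (r - p) * f p - (1 - (r - q) / (r - p)) * f r) * (r - p) := by
    field_simp
    ring
  rw [key, abs_mul, abs_of_pos hd]
  exact mul_le_mul_of_nonneg_right h hd.le

/-- An `ε`-affine function stays close to the line through two points of its graph. -/
theorem abs_sub_chord_le {ε : ℝ} (hε : 0 ≤ ε) {I : Set ℝ} {f : ℝ → ℝ}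
    (hf : ∀ x ∈ I, ∀ y ∈ I, ∀ t ∈ Set.Icc (0 : ℝ) 1,
      |f (t * x + (1 - t) * y) - t * f x - (1 - t) * f y| ≤ ε)
    {a b x : ℝ} (ha : a ∈ I) (hb : b ∈ I) (hx : x ∈ I) (hab : a < b) :
    |f x - (f a + (f b - f a) / (b - a) * (x - a))| ≤
      ε / (b - a) * (|x - a| + |x - b|) := by
  have hd : 0 < b - a := sub_pos.2 hab
  have cleared : |(b - a) * f x - (b - x) * f a - (x - a) * f b| ≤
      ε * (|x - a| + |x - b|) := by
    rcases lt_or_ge x a with hxa | hxa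
    · have h := abs_three_point_le hf hx hb hxa.le hab.le (hxa.trans hab)
      rw [← abs_neg] at h
      calc _ = |-((b - x) * f a - (b - a) * f x - (a - x) * f b)| := by congr 1; ring
        _ ≤ ε * (b - x) := h
        _ ≤ _ := mul_le_mul_of_nonneg_left
          (by linarith [neg_le_abs (x - b), abs_nonneg (x - a)]) hε
    · rcases le_or_gt x b with hxb | hxb
      · exact (abs_three_point_le hf ha hb hxa hxb hab).trans (mul_le_mul_of_nonneg_left
          (by linarith [neg_le_abs (x - b), le_abs_self (x - a)]) hε)
      · have h := abs_three_point_le hf ha hx hab.le hxb.le (hab.trans hxb)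
        rw [← abs_neg] at h
        calc _ = |-((x - a) * f b - (x - b) * f a - (b - a) * f x)| := by congr 1; ring
          _ ≤ ε * (x - a) := h
          _ ≤ _ := mul_le_mul_of_nonneg_left
            (by linarith [le_abs_self (x - a), abs_nonneg (x - b)]) hε
  have key : f x - (f a + (f b - f a) / (b - a) * (x - a)) =
      ((b - a) * f x - (b - x) * f a - (x - a) * f b) / (b - a) := by
    field_simp
    ring
  rw [key, abs_div, abs_of_pos hd, div_le_iff₀ hd]
  refine cleared.trans_eq ?_
  field_simp

theorem convexOn_abs_sub {I : Set ℝ} (hI : Convex ℝ I) (c : ℝ) :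
    ConvexOn ℝ I fun x => |x - c| := by
  simpa only [Real.dist_eq] using convexOn_dist c hI

theorem convexOn_line {I : Set ℝ} (hI : Convex ℝ I) (u m c : ℝ) :
    ConvexOn ℝ I fun x => u + m * (x - c) := by
  refine ⟨hI, fun x _ y _ s t _ _ hst => le_of_eq ?_⟩
  simp only [smul_eq_mul]
  linear_combination (m * c - u) * hst

theorem concaveOn_line {I : Set ℝ} (hI : Convex ℝ I) (u m c : ℝ) :
    ConcaveOn ℝ I fun x => u + m * (x - c) := by
  refine ⟨hI, fun x _ y _ s t _ _ hst => le_of_eq ?_⟩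
  simp only [smul_eq_mul]
  linear_combination (u - m * c) * hst

/-- for ε > 0, a nonempty non-singleton interval `I ⊆ ℝ`
(a convex set with two distinct points) and an ε-affine `f` on `I`, there exist
a convex function `C̄` and a concave function `C̲` on `I` with
`C̲ x - ε/2 ≤ f x ≤ C̄ x + ε/2` on `I`; in particular
`C̲ x - ε/2 ≤ C̄ x + ε/2` on `I`. -/
theorem eps_affine_sandwiched_by_convex_and_concave
    (ε : ℝ) (hε : 0 < ε) (I : Set ℝ) (hI : Convex ℝ I)
    (hI2 : ∃ x ∈ I, ∃ y ∈ I, x ≠ y) (f : ℝ → ℝ)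
    (hf : ∀ x ∈ I, ∀ y ∈ I, ∀ t ∈ Set.Icc (0:ℝ) 1,
      |f (t * x + (1 - t) * y) - t * f x - (1 - t) * f y| ≤ ε) :
    ∃ Cupper Clower : ℝ → ℝ, ConvexOn ℝ I Cupper ∧ ConcaveOn ℝ I Clower ∧
      (∀ x ∈ I, Clower x - ε / 2 ≤ f x ∧ f x ≤ Cupper x + ε / 2) ∧
      (∀ x ∈ I, Clower x - ε / 2 ≤ Cupper x + ε / 2) := by
  obtain ⟨a, ha, b, hb, hab⟩ : ∃ a ∈ I, ∃ b ∈ I, a < b := by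
    obtain ⟨x, hx, y, hy, hxy⟩ := hI2
    rcases hxy.lt_or_gt with h | h
    exacts [⟨x, hx, y, hy, h⟩, ⟨y, hy, x, hx, h⟩]
  have hgap : ConvexOn ℝ I fun x => ε / (b - a) * (|x - a| + |x - b|) :=
    ((convexOn_abs_sub hI a).add (convexOn_abs_sub hI b)).smul
      (div_nonneg hε.le (sub_pos.2 hab).le)
  have hbound : ∀ x ∈ I, _ := fun x hx =>
    abs_le.1 (abs_sub_chord_le hε.le hf ha hb hx hab)
  refine ⟨fun x => f a + (f b - f a) / (b - a) * (x - a) + ε / (b - a) * (|x - a| + |x - b|),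
    fun x => f a + (f b - f a) / (b - a) * (x - a) - ε / (b - a) * (|x - a| + |x - b|),
    (convexOn_line hI _ _ _).add hgap, (concaveOn_line hI _ _ _).sub hgap,
    fun x hx => ⟨?_, ?_⟩, fun x hx => ?_⟩ <;>
  · obtain ⟨h₁, h₂⟩ := hbound x hx
    dsimp only
    linarith
end
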